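/- arXiv:1905.08962 — 2 statements merged into one kernel-verified Lean document; each statement's English description precedes it below -/
import Mathlib

section
/- Let C' = C and let Λ be a (C,C)-controlled g-frame for H with bounds A, B, i.e. for every f ∈ H the family (‖Λ_i C f‖²)_{i∈ι} is summable with A‖f‖² ≤ Σ_{i∈ι} ‖Λ_i C f‖² ≤ B‖f‖². Let S : H → H be the controlled g-frame operator of Λ (bounded, self-adjoint, bijective with bounded inverse), and set Γ_i := Λ_i ∘ C ∘ S⁻¹ : H → H_i. Then (Γ_i)_{i∈ι} is a g-frame for H with bounds 1/B and 1/A: for every f ∈ H, (1/B)‖f‖² ≤ Σ_{i∈ι} ‖Γ_i f‖² ≤ (1/A)‖f‖². -/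
/-- If `Λ` is a `(C,C)`-controlled g-frame with bounds `A, B`, frame operator `S`,
and `Γ_i := Λ_i ∘ C ∘ S⁻¹`, then `(Γ_i)` is a g-frame with bounds `1/B` and `1/A`. -/
theorem stmt_9 {H : Type*} [NormedAddCommGroup H] [InnerProductSpace ℂ H] [CompleteSpace H]
    {ι : Type*} {G : ι → Type*} [∀ i, NormedAddCommGroup (G i)]
    [∀ i, InnerProductSpace ℂ (G i)] [∀ i, CompleteSpace (G i)]
    (Λ : ∀ i, H →L[ℂ] G i) (C : H →L[ℂ] H)
    (hC : ∃ Ci : H →L[ℂ] H, Ci.comp C = 1 ∧ C.comp Ci = 1)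
    (A B : ℝ) (hA : 0 < A) (hAB : A ≤ B)
    (hframe : ∀ f : H, Summable (fun i => ‖Λ i (C f)‖ ^ 2) ∧
      A * ‖f‖ ^ 2 ≤ ∑' i, ‖Λ i (C f)‖ ^ 2 ∧ (∑' i, ‖Λ i (C f)‖ ^ 2) ≤ B * ‖f‖ ^ 2)
    (S : H →L[ℂ] H)
    (hS : ∀ f : H, HasSum (fun i =>
      (ContinuousLinearMap.adjoint C) ((ContinuousLinearMap.adjoint (Λ i)) (Λ i (C f)))) (S f))
    (hSsa : IsSelfAdjoint S)
    (Sinv : H →L[ℂ] H) (hSinv : Sinv.comp S = 1 ∧ S.comp Sinv = 1)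
    (Γ : ∀ i, H →L[ℂ] G i) (hΓ : ∀ i, Γ i = (Λ i).comp (C.comp Sinv)) :
    ∀ f : H, Summable (fun i => ‖Γ i f‖ ^ 2) ∧
      (1 / B) * ‖f‖ ^ 2 ≤ (∑' i, ‖Γ i f‖ ^ 2) ∧ (∑' i, ‖Γ i f‖ ^ 2) ≤ (1 / A) * ‖f‖ ^ 2 := by
  have hB : 0 < B := lt_of_lt_of_le hA hAB
  have hq : ∀ x : H, (∑' i, ‖Λ i (C x)‖ ^ 2) = (inner ℂ x (S x)).re := by
    intro x
    have h1 := (hS x).mapL (innerSL ℂ x)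
    have h2 := h1.mapL Complex.reCLM
    have h3 : (fun i => Complex.reCLM (innerSL ℂ x ((ContinuousLinearMap.adjoint C)
        ((ContinuousLinearMap.adjoint (Λ i)) (Λ i (C x)))))) = fun i => ‖Λ i (C x)‖ ^ 2 := by
      funext i
      rw [innerSL_apply_apply, ContinuousLinearMap.adjoint_inner_right,
        ContinuousLinearMap.adjoint_inner_right, inner_self_eq_norm_sq_to_K]
      simp [← Complex.ofReal_pow]
    rw [h3] at h2
    simpa using h2.tsum_eq
  intro f
  obtain ⟨g, rfl⟩ : ∃ g, f = S g :=
    ⟨Sinv f, by simpa using (DFunLike.congr_fun hSinv.2 f).symm⟩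
  have hΓg : ∀ i, Γ i (S g) = Λ i (C g) := by
    intro i
    have h : Sinv (S g) = g := by simpa using DFunLike.congr_fun hSinv.1 g
    simp [hΓ, h]
  simp only [hΓg]
  obtain ⟨hs, hlo, -⟩ := hframe g
  refine ⟨hs, ?_, ?_⟩
  · obtain ⟨-, hlo2, -⟩ := hframe (g - ((1 / B : ℝ) : ℂ) • S g)
    obtain ⟨-, -, hup⟩ := hframe (S g)
    have h0 : 0 ≤ ∑' i, ‖Λ i (C (g - ((1 / B : ℝ) : ℂ) • S g))‖ ^ 2 :=
      le_trans (by positivity) hlo2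
    have hsym : inner ℂ g (S (S g)) = inner ℂ (S g) (S g) := by
      rw [← ContinuousLinearMap.adjoint_inner_left, hSsa.adjoint_eq]
    have hn : (inner ℂ (S g) (S g)).re = ‖S g‖ ^ 2 := by
      rw [inner_self_eq_norm_sq_to_K]; simp [← Complex.ofReal_pow]
    rw [hq] at h0 hup ⊢
    have e : (inner ℂ (g - ((1 / B : ℝ) : ℂ) • S g) (S (g - ((1 / B : ℝ) : ℂ) • S g))).re
        = (inner ℂ g (S g)).re - 2 * (1 / B) * ‖S g‖ ^ 2
          + (1 / B) * ((1 / B) * (inner ℂ (S g) (S (S g))).re) := by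
      simp only [map_sub, map_smul, inner_sub_left, inner_sub_right, inner_smul_left,
        inner_smul_right, hsym, Complex.conj_ofReal, Complex.sub_re, Complex.re_ofReal_mul, hn]
      ring
    rw [e] at h0
    have h4 : (1 / B) * (inner ℂ (S g) (S (S g))).re ≤ ‖S g‖ ^ 2 := by
      rw [one_div, inv_mul_le_iff₀ hB]; exact hup
    have h5 := mul_le_mul_of_nonneg_left h4 (one_div_pos.2 hB).le
    linarith
  · have hcs : (∑' i, ‖Λ i (C g)‖ ^ 2) ≤ ‖g‖ * ‖S g‖ := by
      rw [hq]; exact re_inner_le_norm (𝕜 := ℂ) g (S g)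
    have hnn : 0 ≤ ∑' i, ‖Λ i (C g)‖ ^ 2 := le_trans (by positivity) hlo
    generalize (∑' i, ‖Λ i (C g)‖ ^ 2) = q at *
    rw [one_div, le_inv_mul_iff₀ hA]
    rcases hnn.eq_or_lt with h | h
    · rw [← h]; simp
    · refine le_of_mul_le_mul_left ?_ h
      calc q * (A * q) = A * (q * q) := by ring
        _ ≤ A * ((‖g‖ * ‖S g‖) * (‖g‖ * ‖S g‖)) := by gcongr
        _ = (A * ‖g‖ ^ 2) * ‖S g‖ ^ 2 := by ring
        _ ≤ q * ‖S g‖ ^ 2 := by gcongr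
end

section
/- Let C' = C, let Λ be a (C,C)-controlled g-frame for H with bounds A, B, let S be its controlled g-frame operator (bounded, self-adjoint, bijective with bounded inverse), and set Γ_i := Λ_i ∘ C ∘ S⁻¹. Let f ∈ H and let g_i ∈ H_i (i ∈ ι) be such that (‖g_i‖²)_{i∈ι} is summable and the family (C* Λ_i* g_i)_{i∈ι} is summable in H with Σ_{i∈ι} C* Λ_i* g_i = f. Then Σ_{i∈ι} ‖g_i‖² = Σ_{i∈ι} ‖Γ_i f‖² + Σ_{i∈ι} ‖g_i − Γ_i f‖². -/
/-- Minimal-norm property of the canonical controlled g-dual: if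
`f = Σ_i C* Λ_i* g_i`, then `Σ‖g_i‖² = Σ‖Γ_i f‖² + Σ‖g_i − Γ_i f‖²`, where
`Γ_i = Λ_i ∘ C ∘ S⁻¹`. -/
theorem stmt_10 {H : Type*} [NormedAddCommGroup H] [InnerProductSpace ℂ H] [CompleteSpace H]
    {ι : Type*} {G : ι → Type*} [∀ i, NormedAddCommGroup (G i)]
    [∀ i, InnerProductSpace ℂ (G i)] [∀ i, CompleteSpace (G i)]
    (Λ : ∀ i, H →L[ℂ] G i) (C : H →L[ℂ] H)
    (hC : ∃ Ci : H →L[ℂ] H, Ci.comp C = 1 ∧ C.comp Ci = 1)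
    (A B : ℝ) (hA : 0 < A) (hAB : A ≤ B)
    (hframe : ∀ f : H, Summable (fun i => ‖Λ i (C f)‖ ^ 2) ∧
      A * ‖f‖ ^ 2 ≤ ∑' i, ‖Λ i (C f)‖ ^ 2 ∧ (∑' i, ‖Λ i (C f)‖ ^ 2) ≤ B * ‖f‖ ^ 2)
    (S : H →L[ℂ] H)
    (hS : ∀ f : H, HasSum (fun i =>
      (ContinuousLinearMap.adjoint C) ((ContinuousLinearMap.adjoint (Λ i)) (Λ i (C f)))) (S f))
    (hSsa : IsSelfAdjoint S)
    (Sinv : H →L[ℂ] H) (hSinv : Sinv.comp S = 1 ∧ S.comp Sinv = 1)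
    (Γ : ∀ i, H →L[ℂ] G i) (hΓ : ∀ i, Γ i = (Λ i).comp (C.comp Sinv))
    (f : H) (g : ∀ i, G i)
    (hg2 : Summable (fun i => ‖g i‖ ^ 2))
    (hrep : HasSum (fun i =>
      (ContinuousLinearMap.adjoint C) ((ContinuousLinearMap.adjoint (Λ i)) (g i))) f) :
    (∑' i, ‖g i‖ ^ 2) = (∑' i, ‖Γ i f‖ ^ 2) + ∑' i, ‖g i - Γ i f‖ ^ 2 := by
  have key : ∀ (w : ∀ i, G i), HasSum (fun i =>
      (ContinuousLinearMap.adjoint C) ((ContinuousLinearMap.adjoint (Λ i)) (w i))) f →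
      HasSum (fun i => (inner ℂ (Γ i f) (w i)).re) (inner ℂ (Sinv f) f).re := by
    intro w hw
    have h1 := Complex.reCLM.hasSum ((innerSL ℂ (Sinv f)).hasSum hw)
    have e : (fun i => (inner ℂ (Γ i f) (w i)).re) = fun i => Complex.reCLM (innerSL ℂ (Sinv f)
        ((ContinuousLinearMap.adjoint C) ((ContinuousLinearMap.adjoint (Λ i)) (w i)))) := by
      funext i
      simp [hΓ, ContinuousLinearMap.adjoint_inner_right]
    rw [e]
    exact h1
  have hSf : S (Sinv f) = f := by
    have := congrArg (fun T : H →L[ℂ] H => T f) hSinv.2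
    simpa using this
  have hv := key (fun i => Γ i f) (by
    have := hS (Sinv f)
    rw [hSf] at this
    convert this using 1
    funext i
    simp [hΓ])
  have hg := key g hrep
  have hv2 : HasSum (fun i => ‖Γ i f‖ ^ 2) (inner ℂ (Sinv f) f).re := by
    convert hv using 1
    funext i
    exact norm_sq_eq_re_inner (𝕜 := ℂ) (Γ i f)
  have hd : HasSum (fun i => ‖g i - Γ i f‖ ^ 2)
      ((∑' i, ‖g i‖ ^ 2) - 2 * (inner ℂ (Sinv f) f).re + (inner ℂ (Sinv f) f).re) := by
    have e : (fun i => ‖g i - Γ i f‖ ^ 2) = fun i =>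
        ‖g i‖ ^ 2 - 2 * (inner ℂ (Γ i f) (g i)).re + ‖Γ i f‖ ^ 2 := by
      funext i
      rw [@norm_sub_sq ℂ, inner_re_symm]
      rfl
    rw [e]
    exact (hg2.hasSum.sub (hg.mul_left 2)).add hv2
  rw [hv2.tsum_eq, hd.tsum_eq]
  ring
end
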